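/- arXiv:1703.06722 — 2 statements merged into one kernel-verified Lean document; each statement's English description precedes it below -/
import Mathlib

section
/- Let A and B be nonzero integers with A² + 4B > 0 such that the Lucas sequence of the second kind v corresponding to (A,B) is non-degenerate. If the set of triples (k,l,m) of nonnegative integers with v_k < v_l < v_m and v_k + v_m = 2·v_l contains more than one element, then this set is infinite. -/
/-- Lucas sequence of the second kind for parameters `A`, `B`:
`v 0 = 2`, `v 1 = A`, `v (n+2) = A * v (n+1) + B * v n`. -/
def lucasV (A B : ℤ) : ℕ → ℤ
  | 0 => 2
  | 1 => A
  | n + 2 => A * lucasV A B (n + 1) + B * lucasV A B n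

/-- The index triples of three-term arithmetic progressions of an integer sequence. -/
def IsAPTriple (v : ℕ → ℤ) (k l m : ℕ) : Prop :=
  v k < v l ∧ v l < v m ∧ v k + v m = 2 * v l

theorem lucasV_add_two (A B : ℤ) (n : ℕ) :
    lucasV A B (n + 2) = A * lucasV A B (n + 1) + B * lucasV A B n := rfl

theorem lucasV_neg (A B : ℤ) (n : ℕ) : lucasV (-A) B n = (-1) ^ n * lucasV A B n := by
  induction n using Nat.twoStepInduction with
  | zero => simp [lucasV]
  | one => simp [lucasV]
  | more n ih₀ ih₁ =>
    rw [lucasV_add_two, lucasV_add_two, ih₀, ih₁]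
    ring

section Positive

variable {A B : ℤ}

theorem lucasV_pos_of_pos (hA : 1 ≤ A) (hB : 1 ≤ B) (n : ℕ) : 0 < lucasV A B n := by
  induction n using Nat.twoStepInduction with
  | zero => simp [lucasV]
  | one => simp only [lucasV]; omega
  | more n ih₀ ih₁ =>
    rw [lucasV_add_two]
    positivity

theorem lucasV_lt_succ_of_pos (hA : 1 ≤ A) (hB : 1 ≤ B) (n : ℕ) :
    lucasV A B (n + 1) < lucasV A B (n + 2) := by
  rw [lucasV_add_two]
  have h₀ := lucasV_pos_of_pos hA hB n
  have h₁ := lucasV_pos_of_pos hA hB (n + 1)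
  nlinarith [mul_pos (show 0 < B by omega) h₀]

theorem lucasV_pos_and_ratio (hA : 1 ≤ A) (hD : 0 < A ^ 2 + 4 * B) (n : ℕ) :
    0 < lucasV A B n ∧ A * lucasV A B n ≤ 2 * lucasV A B (n + 1) := by
  induction n with
  | zero => simp [lucasV, mul_comm]
  | succ n ih =>
    obtain ⟨hpos, hratio⟩ := ih
    have hpos' : 0 < lucasV A B (n + 1) := by
      have : 0 < A * lucasV A B n := by positivity
      omega
    refine ⟨hpos', ?_⟩
    rw [lucasV_add_two]
    nlinarith [mul_le_mul_of_nonneg_left hratio (show 0 ≤ A by omega), mul_pos hD hpos]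

theorem lucasV_le_succ_of_two_le (hA : 2 ≤ A) (hD : 0 < A ^ 2 + 4 * B) (n : ℕ) :
    lucasV A B n ≤ lucasV A B (n + 1) := by
  obtain ⟨hpos, hratio⟩ := lucasV_pos_and_ratio (by omega) hD n
  nlinarith

theorem lucasV_three_neg_two (n : ℕ) : lucasV 3 (-2) (n + 1) = 2 * lucasV 3 (-2) n - 1 := by
  induction n with
  | zero => simp [lucasV]
  | succ n ih => rw [lucasV_add_two]; omega

end Positive

theorem not_isAPTriple_of_two_mul_sub_one_le {v : ℕ → ℤ} (h2 : ∀ n, v 0 ≤ v n) (h0 : 2 ≤ v 0)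
    (hmono : Monotone v) (hgrow : ∀ n, 2 * v (n + 1) - 1 ≤ v (n + 2)) (k l m : ℕ) :
    ¬ IsAPTriple v k l m := by
  rintro ⟨hkl, hlm, heq⟩
  have hk := h2 k
  have hlt : l < m := hmono.reflect_lt hlm
  obtain _ | l := l
  · omega
  · have h₁ := hgrow l
    have h₂ := hmono (show l + 2 ≤ m by omega)
    omega

theorem eq_of_isAPTriple_alternating {w : ℕ → ℤ} (hpos : ∀ n, 0 < w n)
    (hmono : ∀ n, w (n + 1) ≤ w (n + 2)) (hgap : ∀ n, w n + 3 ≤ w (n + 2))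
    (hdouble : ∀ n, 2 * w n ≤ w (n + 2)) (hge : ∀ n, w (n + 1) + 2 * w n - 2 ≤ w (n + 2))
    (hne : ∀ n, w (n + 3) ≠ w (n + 2) + 2 * w (n + 1)) {k l m : ℕ}
    (h : IsAPTriple (fun n => (-1) ^ n * w n) k l m) : k = 1 ∧ l = 0 ∧ m = 2 := by
  have hmono' : Monotone fun n => w (n + 1) := monotone_nat_of_le_succ hmono
  have hgaps (n j : ℕ) : w n + 3 * j ≤ w (n + 2 * j) := by
    induction j with
    | zero => simp
    | succ j ih =>
      have := hgap (n + 2 * j)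
      rw [show n + 2 * (j + 1) = n + 2 * j + 2 by ring]
      push_cast
      omega
  have hpar {x y : ℕ} (hxy : x ≤ y) (hp : x % 2 = y % 2) : w x ≤ w y := by
    have := hgaps x ((y - x) / 2)
    rw [show x + 2 * ((y - x) / 2) = y by omega] at this
    omega
  have hlt {x y : ℕ} (hp : x % 2 = y % 2) (hw : w x < w y) : x + 2 ≤ y := by
    by_contra hc
    have := hpar (show y ≤ x by omega) hp.symm
    omega
  have hsame {x y z : ℕ} (hp : z % 2 = x % 2) (hw : w z < w x) (heq : w x + w y = 2 * w z) :
      False := by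
    have h₁ := hpar (hlt hp hw) (by omega)
    have h₂ := hdouble z
    have h₃ := hpos y
    omega
  have hmixed {x y z : ℕ} (hp : z % 2 = x % 2) (hq : y % 2 ≠ x % 2)
      (heq : w x = w y + 2 * w z) : x = 2 ∧ y = 1 ∧ z = 0 := by
    have hy := hpos y
    have hz := hpos z
    have hzx := hlt hp (by omega)
    obtain ⟨n, rfl⟩ : ∃ n, x = n + 2 := ⟨x - 2, by omega⟩
    have hyx : y ≤ n + 1 := by
      by_contra hc
      have := hmono' (show n + 1 ≤ y - 1 by omega)
      simp only [show y - 1 + 1 = y by omega] at this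
      rw [show n + 1 + 1 = n + 2 by ring] at this
      omega
    have hn := hge n
    have hyn := hpar hyx (by omega)
    have hzn := hpar (show z ≤ n by omega) (by omega)
    have hz' : z = n := by
      by_contra hc
      have h₁ := hpar (show z + 2 ≤ n by omega) (by omega)
      have h₂ := hgap z
      omega
    have hy' : y = n + 1 := by
      by_contra hc
      have h₁ := hpar (show y + 2 ≤ n + 1 by omega) (by omega)
      have h₂ := hgap y
      omega
    subst hz' hy'
    obtain _ | z := z
    · simp
    · exact absurd heq (hne z)
  obtain ⟨h₁, h₂, h₃⟩ := h
  have hk := hpos k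
  have hl := hpos l
  have hm := hpos m
  rcases Nat.even_or_odd k with pk | pk <;> rcases Nat.even_or_odd l with pl | pl <;>
    rcases Nat.even_or_odd m with pm | pm <;>
    simp only [pk.neg_one_pow, pl.neg_one_pow, pm.neg_one_pow, one_mul, neg_mul] at h₁ h₂ h₃ <;>
    simp only [Nat.even_iff, Nat.odd_iff] at pk pl pm
  · exact (hsame (x := m) (y := k) (z := l) (by omega) (by omega) (by omega)).elim
  · omega
  · omega
  · omega
  · have := hmixed (x := m) (y := k) (z := l) (by omega) (by omega) (by omega)
    omega
  · omega
  · have := hmixed (x := k) (y := m) (z := l) (by omega) (by omega) (by omega)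
    omega
  · exact (hsame (x := k) (y := m) (z := l) (by omega) (by omega) (by omega)).elim

theorem not_isAPTriple_lucasV_of_two_le {A B : ℤ} (hA : 2 ≤ A) (hB : B ≠ 0)
    (hD : 0 < A ^ 2 + 4 * B) (k l m : ℕ) : ¬ IsAPTriple (lucasV A B) k l m := by
  have key : Monotone (lucasV A B) ∧
      ∀ n, 2 * lucasV A B (n + 1) - 1 ≤ lucasV A B (n + 2) := by
    rcases lt_or_gt_of_ne hB with hB | hB
    · have hmono := lucasV_le_succ_of_two_le hA hD
      refine ⟨monotone_nat_of_le_succ hmono, fun n => ?_⟩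
      obtain hA4 | hA3 := le_or_gt 4 A
      · obtain ⟨hpos, hratio⟩ := lucasV_pos_and_ratio (by omega) hD (n + 1)
        rw [show n + 2 = n + 1 + 1 by ring]
        nlinarith
      · obtain rfl : A = 3 := by
          obtain rfl | rfl : A = 2 ∨ A = 3 := by omega
          · omega
          · rfl
        obtain rfl | rfl : B = -1 ∨ B = -2 := by omega
        · have := hmono n
          rw [lucasV_add_two]
          omega
        · exact (lucasV_three_neg_two (n + 1)).ge
    · refine ⟨monotone_nat_of_le_succ fun n => ?_, fun n => ?_⟩
      · obtain _ | n := n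
        · simpa [lucasV] using hA
        · exact (lucasV_lt_succ_of_pos (by omega) hB n).le
      · rw [lucasV_add_two]
        have h₀ := lucasV_pos_of_pos (show 1 ≤ A by omega) hB n
        have h₁ := lucasV_pos_of_pos (show 1 ≤ A by omega) hB (n + 1)
        nlinarith [mul_pos hB h₀]
  exact not_isAPTriple_of_two_mul_sub_one_le (fun n => key.1 (Nat.zero_le n)) (by simp [lucasV])
    key.1 key.2 k l m

theorem eq_of_isAPTriple_lucasV_one {B : ℤ} (hB : 2 ≤ B) {k l m : ℕ}
    (h : IsAPTriple (lucasV 1 B) k l m) : k = 1 ∧ l = 4 ∧ m = 5 := by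
  obtain ⟨h₁, h₂, h₃⟩ := h
  have hpos := lucasV_pos_of_pos (le_refl 1) (show 1 ≤ B by omega)
  have hrec (n : ℕ) : lucasV 1 B (n + 2) = lucasV 1 B (n + 1) + B * lucasV 1 B n := by
    rw [lucasV_add_two, one_mul]
  have hstrict : StrictMono fun n => lucasV 1 B (n + 1) :=
    strictMono_nat_of_lt_succ (lucasV_lt_succ_of_pos (le_refl 1) (by omega))
  have v0 : lucasV 1 B 0 = 2 := rfl
  have v1 : lucasV 1 B 1 = 1 := rfl
  have v2 : lucasV 1 B 2 = 1 + 2 * B := by rw [hrec, v0, v1]; ring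
  have v3 : lucasV 1 B 3 = 1 + 3 * B := by rw [hrec, v1, v2]; ring
  have hge2 (n : ℕ) : 1 + 2 * B ≤ lucasV 1 B (n + 2) := by
    rw [← v2]
    exact hstrict.monotone (show 1 ≤ n + 1 by omega)
  have hval (j : ℕ) : lucasV 1 B j = 2 ∨ j = 1 ∧ lucasV 1 B j = 1 ∨
      1 + 2 * B ≤ lucasV 1 B j := by
    obtain rfl | rfl | ⟨j, rfl⟩ : j = 0 ∨ j = 1 ∨ ∃ i, j = i + 2 := by
      obtain _ | _ | j := j <;> simp
    · exact Or.inl v0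
    · exact Or.inr (Or.inl ⟨rfl, v1⟩)
    · exact Or.inr (Or.inr (hge2 j))
  have hvalk := hval k
  have hk : 0 < lucasV 1 B k := hpos k
  have hl : 2 ≤ l := by
    by_contra hc
    obtain rfl | rfl : l = 0 ∨ l = 1 := by omega
    · have := hval m
      omega
    · omega
  obtain ⟨n, rfl⟩ : ∃ n, l = n + 2 := ⟨l - 2, by omega⟩
  have hlm : n + 2 < m := by
    obtain _ | m := m
    · have := hge2 n
      omega
    · have := hstrict.lt_iff_lt.1 (show lucasV 1 B (n + 1 + 1) < lucasV 1 B (m + 1) from h₂)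
      omega
  have hm : m = n + 3 := by
    by_contra hc
    have hmn := hstrict.monotone (show n + 3 ≤ m - 1 by omega)
    simp only [show m - 1 + 1 = m by omega] at hmn
    have := hrec (n + 2)
    have := hpos (n + 3)
    have := hpos (n + 2)
    nlinarith
  subst hm
  have hvk : lucasV 1 B k = lucasV 1 B (n + 2) - B * lucasV 1 B (n + 1) := by
    have := hrec (n + 1)
    rw [show n + 1 + 2 = n + 3 by ring, show n + 1 + 1 = n + 2 by ring] at this
    omega
  obtain rfl | hB3 := eq_or_lt_of_le hB
  · have habs (n : ℕ) : lucasV 1 2 (n + 1) - 2 * lucasV 1 2 n = 3 ∨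
        lucasV 1 2 (n + 1) - 2 * lucasV 1 2 n = -3 := by
      induction n with
      | zero => simp [lucasV]
      | succ n ih =>
        have := hrec n
        rw [show n + 1 + 1 = n + 2 by ring]
        omega
    have := habs (n + 1)
    rw [show n + 1 + 1 = n + 2 by ring] at this
    omega
  · obtain _ | _ | _ | n := n
    · rw [zero_add, zero_add, v1, v2] at hvk
      omega
    · rw [show 0 + 1 + 2 = 3 from rfl, show 0 + 1 + 1 = 2 from rfl, v2, v3] at hvk
      nlinarith
    · have v4 : lucasV 1 B 4 = 1 + 4 * B + 2 * B ^ 2 := by rw [hrec, v2, v3]; ring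
      rw [show 0 + 1 + 1 + 2 = 4 from rfl, show 0 + 1 + 1 + 1 = 3 from rfl, v3, v4] at hvk
      obtain rfl : B = 3 := by
        by_contra hc
        have : 4 ≤ B := by omega
        nlinarith
      omega
    · have h5 := hrec (n + 3)
      have h4 := hrec (n + 2)
      have h3 := hrec (n + 1)
      have hlt := lucasV_lt_succ_of_pos (le_refl 1) (show 1 ≤ B by omega) n
      have hp := hpos (n + 1)
      have hexp : lucasV 1 B k =
          B * lucasV 1 B (n + 1) - (B ^ 2 - B - 1) * lucasV 1 B (n + 2) := by
        rw [hvk]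
        change lucasV 1 B (n + 3 + 2) - B * lucasV 1 B (n + 2 + 2) = _
        rw [h5]
        change lucasV 1 B (n + 2 + 2) + B * lucasV 1 B (n + 1 + 2) -
          B * lucasV 1 B (n + 2 + 2) = _
        rw [h4]
        change lucasV 1 B (n + 1 + 2) + B * lucasV 1 B (n + 2) + B * lucasV 1 B (n + 1 + 2) -
          B * (lucasV 1 B (n + 1 + 2) + B * lucasV 1 B (n + 2)) = _
        rw [h3]
        change lucasV 1 B (n + 2) + B * lucasV 1 B (n + 1) + B * lucasV 1 B (n + 2) +
          B * (lucasV 1 B (n + 2) + B * lucasV 1 B (n + 1)) -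
          B * (lucasV 1 B (n + 2) + B * lucasV 1 B (n + 1) + B * lucasV 1 B (n + 2)) = _
        ring
      have hcoef : B ≤ B ^ 2 - B - 1 := by nlinarith
      nlinarith [mul_le_mul_of_nonneg_right hcoef (hpos (n + 2)).le]

theorem eq_of_isAPTriple_lucasV_neg {a B : ℤ} (ha : 1 ≤ a) (hB : B ≠ 0)
    (hD : 0 < a ^ 2 + 4 * B) (hex : a = 1 → 3 ≤ B) {k l m : ℕ}
    (h : IsAPTriple (lucasV (-a) B) k l m) : k = 1 ∧ l = 0 ∧ m = 2 := by
  rw [funext (lucasV_neg a B)] at h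
  have v0 : lucasV a B 0 = 2 := rfl
  have v1 : lucasV a B 1 = a := rfl
  have key : (∀ n, 0 < lucasV a B n) ∧ (∀ n, lucasV a B (n + 1) ≤ lucasV a B (n + 2)) ∧
      ((∀ n, 3 ≤ lucasV a B n + lucasV a B (n + 1)) ∧
        (∀ n, lucasV a B (n + 1) + 2 * lucasV a B n ≤ lucasV a B (n + 2)) ∧
        (∀ n, lucasV a B (n + 2) + 2 * lucasV a B (n + 1) < lucasV a B (n + 3)) ∨
      a = 3 ∧ B = -2) := by
    rcases lt_or_gt_of_ne hB with hB | hB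
    · have ha3 : 3 ≤ a := by nlinarith
      have hpos (n : ℕ) := (lucasV_pos_and_ratio ha hD n).1
      have hratio (n : ℕ) := (lucasV_pos_and_ratio ha hD n).2
      have hmono := lucasV_le_succ_of_two_le (by omega) hD
      have hmono' : Monotone (lucasV a B) := monotone_nat_of_le_succ hmono
      refine ⟨hpos, fun n => hmono (n + 1), ?_⟩
      have hsum (n : ℕ) : 3 ≤ lucasV a B n + lucasV a B (n + 1) := by
        have h₁ := hmono' (Nat.zero_le n)
        have h₂ := hmono' (Nat.zero_le (n + 1))
        omega
      obtain ha4 | ha4 := le_or_gt 4 a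
      · have hgt (n : ℕ) : lucasV a B (n + 1) + 2 * lucasV a B n < lucasV a B (n + 2) := by
          rw [lucasV_add_two]
          have h₁ := mul_le_mul_of_nonneg_left (hratio n) (show 0 ≤ a - 1 by omega)
          have h₂ : 0 < 2 * a ^ 2 - 2 * a + 4 * B - 8 := by nlinarith
          nlinarith [mul_pos h₂ (hpos n)]
        exact Or.inl ⟨hsum, fun n => (hgt n).le, fun n => hgt (n + 1)⟩
      · obtain rfl : a = 3 := by omega
        obtain rfl | rfl : B = -1 ∨ B = -2 := by omega
        · refine Or.inl ⟨hsum, fun n => ?_, fun n => ?_⟩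
          · have := hratio n
            rw [lucasV_add_two]
            omega
          · have h₁ := hratio n
            have h₂ := hpos n
            have h₃ := lucasV_add_two 3 (-1) n
            have h₄ := lucasV_add_two 3 (-1) (n + 1)
            change lucasV 3 (-1) (n + 3) = 3 * lucasV 3 (-1) (n + 2) + _ at h₄
            omega
        · exact Or.inr ⟨rfl, rfl⟩
    · have hpos := lucasV_pos_of_pos ha hB
      have hlt := lucasV_lt_succ_of_pos ha hB
      refine ⟨hpos, fun n => (hlt n).le, Or.inl ⟨fun n => ?_, ?_⟩⟩
      · obtain _ | n := n
        · rw [zero_add]; omega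
        · have := hlt n
          have := hpos (n + 1)
          rw [show n + 1 + 1 = n + 2 by ring]
          omega
      · by_cases hspecial : a = 2 ∧ B = 1
        · obtain ⟨rfl, rfl⟩ := hspecial
          refine ⟨fun n => ?_, fun n => ?_⟩
          · rw [lucasV_add_two]
            obtain _ | n := n
            · simp [lucasV]
            · have := hlt n
              rw [show n + 1 + 1 = n + 2 by ring]
              omega
          · have := hlt n
            have h₄ := lucasV_add_two 2 1 (n + 1)
            change lucasV 2 1 (n + 3) = 2 * lucasV 2 1 (n + 2) + _ at h₄
            omega
        · have hgt (n : ℕ) : lucasV a B (n + 1) + 2 * lucasV a B n < lucasV a B (n + 2) := by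
            have h₀ := hpos n
            have h₁ := hpos (n + 1)
            rw [lucasV_add_two]
            obtain hB2 | hB2 := le_or_gt 2 B
            · obtain rfl | ha2 := eq_or_lt_of_le ha
              · have := hex rfl
                nlinarith
              · nlinarith
            · obtain rfl : B = 1 := by omega
              have ha3 : 3 ≤ a := by
                by_contra hc
                obtain rfl | rfl : a = 1 ∨ a = 2 := by omega
                · exact absurd (hex rfl) (by norm_num)
                · simp at hspecial
              have : lucasV a 1 n ≤ lucasV a 1 (n + 1) := by
                obtain _ | n := n
                · rw [zero_add]; omega
                · exact (hlt n).le
              nlinarith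
          exact ⟨fun n => (hgt n).le, fun n => hgt (n + 1)⟩
  obtain ⟨hpos, hmono, ⟨hsum, hge, hgt⟩ | ⟨rfl, rfl⟩⟩ := key
  · refine eq_of_isAPTriple_alternating hpos hmono (fun n => ?_) (fun n => ?_) (fun n => ?_)
      (fun n => (hgt n).ne') h
    · have := hge n
      have := hsum n
      omega
    · have := hge n
      have := hpos (n + 1)
      omega
    · have := hge n
      omega
  · have hrec := lucasV_three_neg_two
    have hge2 (n : ℕ) : 2 ≤ lucasV 3 (-2) n := by
      induction n with
      | zero => simp [lucasV]
      | succ n ih => rw [hrec]; omega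
    have hrec' (n : ℕ) : lucasV 3 (-2) (n + 2) = 2 * lucasV 3 (-2) (n + 1) - 1 := hrec (n + 1)
    have hrec'' (n : ℕ) : lucasV 3 (-2) (n + 3) = 2 * lucasV 3 (-2) (n + 2) - 1 := hrec (n + 2)
    refine eq_of_isAPTriple_alternating hpos hmono (fun n => ?_) (fun n => ?_) (fun n => ?_)
      (fun n => ?_) h <;>
    · have := hrec n
      have := hrec' n
      have := hrec'' n
      have := hge2 n
      omega

theorem isAPTriple_lucasV_one_one (n : ℕ) :
    IsAPTriple (lucasV 1 1) (n + 1) (n + 3) (n + 4) := by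
  have h₀ := lucasV_pos_of_pos le_rfl le_rfl (A := 1) (B := 1) (n + 1)
  have h₁ := lucasV_pos_of_pos le_rfl le_rfl (A := 1) (B := 1) (n + 2)
  have h₃ : lucasV 1 1 (n + 3) = 1 * lucasV 1 1 (n + 2) + 1 * lucasV 1 1 (n + 1) := rfl
  have h₄ : lucasV 1 1 (n + 4) = 1 * lucasV 1 1 (n + 3) + 1 * lucasV 1 1 (n + 2) := rfl
  refine ⟨?_, ?_, ?_⟩ <;> omega

theorem isAPTriple_lucasV_neg_one_one (n : ℕ) :
    IsAPTriple (lucasV (-1) 1) (2 * n + 1) (2 * n + 2) (2 * n + 4) := by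
  have h₁ := lucasV_neg 1 1 (2 * n + 1)
  have h₂ := lucasV_neg 1 1 (2 * n + 2)
  rw [Odd.neg_one_pow ⟨n, rfl⟩] at h₁
  rw [Even.neg_one_pow ⟨n + 1, by ring⟩] at h₂
  have p₁ := lucasV_pos_of_pos le_rfl le_rfl (A := 1) (B := 1) (2 * n + 1)
  have p₂ := lucasV_pos_of_pos le_rfl le_rfl (A := 1) (B := 1) (2 * n + 2)
  have h₃ : lucasV (-1) 1 (2 * n + 3) =
    -1 * lucasV (-1) 1 (2 * n + 2) + 1 * lucasV (-1) 1 (2 * n + 1) := rfl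
  have h₄ : lucasV (-1) 1 (2 * n + 4) =
    -1 * lucasV (-1) 1 (2 * n + 3) + 1 * lucasV (-1) 1 (2 * n + 2) := rfl
  refine ⟨?_, ?_, ?_⟩ <;> omega

theorem isAPTriple_lucasV_neg_one_two (n : ℕ) :
    IsAPTriple (lucasV (-1) 2) (2 * n + 1) (2 * n) (2 * n + 2) := by
  have h₀ := lucasV_neg 1 2 (2 * n)
  have h₁ := lucasV_neg 1 2 (2 * n + 1)
  rw [Even.neg_one_pow ⟨n, by ring⟩] at h₀
  rw [Odd.neg_one_pow ⟨n, rfl⟩] at h₁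
  have p₀ := lucasV_pos_of_pos le_rfl one_le_two (A := 1) (B := 2) (2 * n)
  have p₁ := lucasV_pos_of_pos le_rfl one_le_two (A := 1) (B := 2) (2 * n + 1)
  have h₂ := lucasV_add_two (-1) 2 (2 * n)
  refine ⟨?_, ?_, ?_⟩ <;> omega

theorem stmt_11 (A B : ℤ) (hA : A ≠ 0) (hB : B ≠ 0) (hdom : A ^ 2 + 4 * B > 0)
    (hnd : ∀ α β : ℂ, α + β = (A : ℂ) → α * β = -(B : ℂ) →
      ∀ n : ℕ, 0 < n → (α / β) ^ n ≠ 1)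
    (hmore : ∃ p q : ℕ × ℕ × ℕ, p ≠ q ∧
      p ∈ {p : ℕ × ℕ × ℕ | lucasV A B p.1 < lucasV A B p.2.1 ∧
        lucasV A B p.2.1 < lucasV A B p.2.2 ∧
        lucasV A B p.1 + lucasV A B p.2.2 = 2 * lucasV A B p.2.1} ∧
      q ∈ {p : ℕ × ℕ × ℕ | lucasV A B p.1 < lucasV A B p.2.1 ∧
        lucasV A B p.2.1 < lucasV A B p.2.2 ∧
        lucasV A B p.1 + lucasV A B p.2.2 = 2 * lucasV A B p.2.1}) :
    {p : ℕ × ℕ × ℕ | lucasV A B p.1 < lucasV A B p.2.1 ∧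
        lucasV A B p.2.1 < lucasV A B p.2.2 ∧
        lucasV A B p.1 + lucasV A B p.2.2 = 2 * lucasV A B p.2.1}.Infinite := by
  change {p : ℕ × ℕ × ℕ | IsAPTriple (lucasV A B) p.1 p.2.1 p.2.2}.Infinite
  by_cases h₁ : A = 1 ∧ B = 1
  · obtain ⟨rfl, rfl⟩ := h₁
    exact Set.infinite_of_injective_forall_mem (f := fun n : ℕ => (n + 1, n + 3, n + 4))
      (fun x y h => by simpa using h) isAPTriple_lucasV_one_one
  by_cases h₂ : A = -1 ∧ B = 1
  · obtain ⟨rfl, rfl⟩ := h₂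
    exact Set.infinite_of_injective_forall_mem
      (f := fun n : ℕ => (2 * n + 1, 2 * n + 2, 2 * n + 4))
      (fun x y h => by simpa using h) isAPTriple_lucasV_neg_one_one
  by_cases h₃ : A = -1 ∧ B = 2
  · obtain ⟨rfl, rfl⟩ := h₃
    exact Set.infinite_of_injective_forall_mem (f := fun n : ℕ => (2 * n + 1, 2 * n, 2 * n + 2))
      (fun x y h => by simpa using h) isAPTriple_lucasV_neg_one_two
  exfalso
  obtain ⟨⟨k, l, m⟩, ⟨k', l', m'⟩, hpq, hp, hq⟩ := hmore
  change IsAPTriple (lucasV A B) k l m at hp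
  change IsAPTriple (lucasV A B) k' l' m' at hq
  apply hpq
  simp only [Prod.mk.injEq]
  obtain hneg | rfl | hpos : A < 0 ∨ A = 1 ∨ 2 ≤ A := by omega
  · obtain ⟨a, rfl⟩ : ∃ a, A = -a := ⟨-A, by ring⟩
    rw [neg_sq] at hdom
    have hex : a = 1 → 3 ≤ B := by
      rintro rfl
      omega
    have h := eq_of_isAPTriple_lucasV_neg (by omega) hB hdom hex hp
    have h' := eq_of_isAPTriple_lucasV_neg (by omega) hB hdom hex hq
    omega
  · have h := eq_of_isAPTriple_lucasV_one (by omega) hp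
    have h' := eq_of_isAPTriple_lucasV_one (by omega) hq
    omega
  · exact absurd hp (not_isAPTriple_lucasV_of_two_le hpos hB hdom k l m)
end

section
/- Let A and B be nonzero integers with A² + 4B > 0, and let u be the Lucas sequence of the first kind corresponding to (A,B). Assume that none of the following holds: (B < 0 and |A| ≤ 6), (|A| = 1 and 0 < B ≤ 9), (|A| = 2 and 0 < B ≤ 3). Then for all nonnegative integers n > n' such that n is odd or n ≥ 8, one has |u_n| > 3·|u_{n'}|. -/
/-- Lucas sequence of the first kind for parameters `A`, `B`:
`u 0 = 0`, `u 1 = 1`, `u (n+2) = A * u (n+1) + B * u n`. -/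
def lucasU (A B : ℤ) : ℕ → ℤ
  | 0 => 0
  | 1 => 1
  | n + 2 => A * lucasU A B (n + 1) + B * lucasU A B n

theorem lucasU_add_two (A B : ℤ) (n : ℕ) :
    lucasU A B (n + 2) = A * lucasU A B (n + 1) + B * lucasU A B n := rfl

theorem lucasU_neg_left (A B : ℤ) (n : ℕ) :
    lucasU (-A) B n = (-1) ^ (n + 1) * lucasU A B n := by
  induction n using Nat.twoStepInduction with
  | zero => simp [lucasU]
  | one => simp [lucasU]
  | more n ih ih' =>
    rw [lucasU_add_two, lucasU_add_two, ih, ih']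
    ring

theorem abs_lucasU_abs_left (A B : ℤ) (n : ℕ) : |lucasU |A| B n| = |lucasU A B n| := by
  rcases abs_choice A with h | h <;> rw [h]
  rw [lucasU_neg_left, abs_mul]
  simp

theorem lucasU_nonneg_le_succ_of_pos {A B : ℤ} (hA : 0 < A) (hB : 0 < B) (n : ℕ) :
    0 ≤ lucasU A B n ∧ lucasU A B n ≤ lucasU A B (n + 1) := by
  induction n with
  | zero => simp [lucasU]
  | succ n ih =>
    have h := ih.1.trans ih.2
    refine ⟨h, ?_⟩
    rw [lucasU_add_two]
    nlinarith [mul_nonneg hB.le ih.1]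

theorem lucasU_half_growth {A B : ℤ} (hA : 0 < A) (hdom : 0 < A ^ 2 + 4 * B) (n : ℕ) :
    0 ≤ lucasU A B n ∧ 0 < lucasU A B (n + 1) ∧
      A * lucasU A B n ≤ 2 * lucasU A B (n + 1) := by
  induction n with
  | zero => simp [lucasU]
  | succ n ih =>
    obtain ⟨h0, h1, h2⟩ := ih
    have h3 : A * lucasU A B (n + 1) ≤ 2 * lucasU A B (n + 2) := by
      rw [lucasU_add_two]
      nlinarith [mul_nonneg hdom.le h0, mul_le_mul_of_nonneg_left h2 hA.le]
    refine ⟨h1.le, ?_, h3⟩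
    nlinarith [mul_pos hA h1]

theorem three_mul_lucasU_lt_of_neg {A B : ℤ} (hA : 7 ≤ A) (hdom : 0 < A ^ 2 + 4 * B) (n : ℕ) :
    0 ≤ lucasU A B n ∧ 3 * lucasU A B n < lucasU A B (n + 1) := by
  obtain ⟨h0, h1, h2⟩ := lucasU_half_growth (by linarith) hdom n
  exact ⟨h0, by nlinarith⟩

theorem three_mul_lucasU_lt_add_two {A B : ℤ} (hA : 0 < A) (hB : 0 < B)
    (h1 : A = 1 → 10 ≤ B) (h2 : A = 2 → 4 ≤ B) {n : ℕ}
    (h : 3 * lucasU A B n < lucasU A B (n + 1)) :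
    3 * lucasU A B (n + 2) < lucasU A B (n + 3) := by
  have h0 := (lucasU_nonneg_le_succ_of_pos hA hB n).1
  rw [lucasU_add_two A B (n + 1), lucasU_add_two A B n]
  generalize lucasU A B n = x at *
  generalize lucasU A B (n + 1) = y at *
  rcases (by omega : A = 1 ∨ A = 2 ∨ 3 ≤ A) with rfl | rfl | hA3
  · nlinarith [h1 rfl]
  · nlinarith [h2 rfl]
  · have hy : 0 < y := by linarith
    have hw : 0 ≤ A * y + B * x := by positivity
    nlinarith [mul_pos hB hy]

theorem three_mul_lucasU_seven_lt {A B : ℤ} (hA : 0 < A) (hB : 0 < B)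
    (h1 : A = 1 → 10 ≤ B) (h2 : A = 2 → 4 ≤ B) :
    3 * lucasU A B 7 < lucasU A B 8 := by
  rcases (by omega : A = 1 ∨ A = 2 ∨ 3 ≤ A) with rfl | rfl | hA3
  · obtain ⟨c, rfl⟩ := Int.le.dest (h1 rfl)
    simp only [lucasU]
    ring_nf
    nlinarith [Int.natCast_nonneg c, pow_nonneg (Int.natCast_nonneg c) 2,
      pow_nonneg (Int.natCast_nonneg c) 3]
  · obtain ⟨c, rfl⟩ := Int.le.dest (h2 rfl)
    simp only [lucasU]
    ring_nf
    nlinarith [Int.natCast_nonneg c, pow_nonneg (Int.natCast_nonneg c) 2,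
      pow_nonneg (Int.natCast_nonneg c) 3]
  · have hmono := lucasU_nonneg_le_succ_of_pos hA hB
    have h6 : 0 < lucasU A B 6 := by
      have := (hmono 1).2.trans ((hmono 2).2.trans ((hmono 3).2.trans
        ((hmono 4).2.trans (hmono 5).2)))
      exact lt_of_lt_of_le (by simp [lucasU]) this
    have h7 := (hmono 7).1
    rw [lucasU_add_two A B 6]
    nlinarith [mul_pos hB h6]

theorem three_mul_lucasU_lt_of_pos {A B : ℤ} (hA : 0 < A) (hB : 0 < B)
    (h1 : A = 1 → 10 ≤ B) (h2 : A = 2 → 4 ≤ B) (n : ℕ) (hn : Even n ∨ 7 ≤ n) :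
    3 * lucasU A B n < lucasU A B (n + 1) := by
  induction n using Nat.twoStepInduction with
  | zero => simp [lucasU]
  | one => simp at hn
  | more n ih _ =>
    by_cases h : Even n ∨ 7 ≤ n
    · exact three_mul_lucasU_lt_add_two hA hB h1 h2 (ih h)
    · have : n = 5 := by grind
      subst this
      exact three_mul_lucasU_seven_lt hA hB h1 h2

theorem stmt_13 (A B : ℤ) (hA : A ≠ 0) (hB : B ≠ 0) (hdom : A ^ 2 + 4 * B > 0)
    (h1 : ¬ (B < 0 ∧ |A| ≤ 6)) (h2 : ¬ (|A| = 1 ∧ 0 < B ∧ B ≤ 9))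
    (h3 : ¬ (|A| = 2 ∧ 0 < B ∧ B ≤ 3)) :
    ∀ n n' : ℕ, n' < n → (Odd n ∨ 8 ≤ n) →
      |lucasU A B n| > 3 * |lucasU A B n'| := by
  intro n n' hlt hn
  obtain ⟨m, rfl⟩ : ∃ m, n = m + 1 := ⟨n - 1, by omega⟩
  have hm : Even m ∨ 7 ≤ m := by grind
  have hA' : 0 < |A| := abs_pos.mpr hA
  have hdom' : 0 < |A| ^ 2 + 4 * B := by rwa [sq_abs]
  rw [← abs_lucasU_abs_left A B, ← abs_lucasU_abs_left A B]
  generalize |A| = a at *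
  suffices h : (∀ k, 0 ≤ lucasU a B k ∧ lucasU a B k ≤ lucasU a B (k + 1)) ∧
      3 * lucasU a B m < lucasU a B (m + 1) by
    have hmono : Monotone (lucasU a B) := monotone_nat_of_le_succ fun k => (h.1 k).2
    rw [abs_of_nonneg (h.1 _).1, abs_of_nonneg (h.1 _).1]
    have := hmono (Nat.lt_succ_iff.mp hlt)
    linarith [h.2]
  rcases lt_or_gt_of_ne hB with hneg | hpos
  · have key := three_mul_lucasU_lt_of_neg (A := a) (B := B) (by grind) hdom'
    exact ⟨fun k => ⟨(key k).1, by linarith [(key k).1, (key k).2]⟩, (key m).2⟩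
  · exact ⟨lucasU_nonneg_le_succ_of_pos hA' hpos,
      three_mul_lucasU_lt_of_pos hA' hpos (by grind) (by grind) m hm⟩
end
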